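/- Let L be a field of characteristic 0 and let x₁, x₂, x₃ ∈ L be algebraically independent over ℚ. If h is a Möbius involution over L (a non-identity fractional linear transformation whose square is the identity) that maps the six-element set B₂ = {x₁, −x₁, x₂, −x₂, x₃, −x₃} onto itself, then h is the map x ↦ −x. -/

import Mathlib

open MvPolynomial in
/-- The six points `±X₀, ±X₁, ±X₂` as polynomials. -/
noncomputable def signedVar : Fin 6 → MvPolynomial (Fin 3) ℚ :=
  ![X 0, -X 0, X 1, -X 1, X 2, -X 2]

/-- An integer specialization of `signedVar`. -/
def signedInt : Fin 6 → ℤ := ![1, -1, 10, -10, 1000, -1000]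

/-- The determinant of the matrix with rows `(t * s, t + s, 1)` for three pairs `(t, s)`.
It vanishes when a single Möbius involution exchanges the members of each pair. -/
def involutionDet {R : Type*} [CommRing R] (t₁ s₁ t₂ s₂ t₃ s₃ : R) : R :=
  t₁ * s₁ * ((t₂ + s₂) - (t₃ + s₃)) + t₂ * s₂ * ((t₃ + s₃) - (t₁ + s₁))
    + t₃ * s₃ * ((t₁ + s₁) - (t₂ + s₂))

lemma map_involutionDet {R S : Type*} [CommRing R] [CommRing S] (f : R →+* S)
    (t₁ s₁ t₂ s₂ t₃ s₃ : R) :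
    f (involutionDet t₁ s₁ t₂ s₂ t₃ s₃) =
      involutionDet (f t₁) (f s₁) (f t₂) (f s₂) (f t₃) (f s₃) := by
  simp [involutionDet]

lemma involutionDet_eq_zero {L : Type*} [Field L] {a b c : L} (h : a * a + b * c ≠ 0)
    {t₁ s₁ t₂ s₂ t₃ s₃ : L}
    (h₁ : c * (t₁ * s₁) - a * (t₁ + s₁) - b = 0)
    (h₂ : c * (t₂ * s₂) - a * (t₂ + s₂) - b = 0)
    (h₃ : c * (t₃ * s₃) - a * (t₃ + s₃) - b = 0) :
    involutionDet t₁ s₁ t₂ s₂ t₃ s₃ = 0 := by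
  have hc : involutionDet t₁ s₁ t₂ s₂ t₃ s₃ * c = 0 := by
    unfold involutionDet
    linear_combination ((t₂ + s₂) - (t₃ + s₃)) * h₁ + ((t₃ + s₃) - (t₁ + s₁)) * h₂
      + ((t₁ + s₁) - (t₂ + s₂)) * h₃
  have ha : involutionDet t₁ s₁ t₂ s₂ t₃ s₃ * a = 0 := by
    unfold involutionDet
    linear_combination (t₂ * s₂ - t₃ * s₃) * h₁ + (t₃ * s₃ - t₁ * s₁) * h₂
      + (t₁ * s₁ - t₂ * s₂) * h₃
  refine (mul_eq_zero.mp ?_).resolve_right h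
  linear_combination a * ha + b * hc

lemma eval_signedVar (i : Fin 6) :
    MvPolynomial.eval ![1, 10, 1000] (signedVar i) = (signedInt i : ℚ) := by
  fin_cases i <;> simp [signedVar, signedInt]

lemma involutionDet_signedInt_eq_zero {L : Type*} [Field L] [CharZero L] {x : Fin 3 → L}
    (hx : AlgebraicIndependent ℚ x) {i₁ j₁ i₂ j₂ i₃ j₃ : Fin 6}
    (h : involutionDet (MvPolynomial.aeval x (signedVar i₁)) (MvPolynomial.aeval x (signedVar j₁))
      (MvPolynomial.aeval x (signedVar i₂)) (MvPolynomial.aeval x (signedVar j₂))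
      (MvPolynomial.aeval x (signedVar i₃)) (MvPolynomial.aeval x (signedVar j₃)) = 0) :
    involutionDet (signedInt i₁) (signedInt j₁) (signedInt i₂) (signedInt j₂)
      (signedInt i₃) (signedInt j₃) = 0 := by
  have h0 := algebraicIndependent_iff.mp hx (involutionDet (signedVar i₁) (signedVar j₁)
    (signedVar i₂) (signedVar j₂) (signedVar i₃) (signedVar j₃))
    ((map_involutionDet (MvPolynomial.aeval x : MvPolynomial (Fin 3) ℚ →ₐ[ℚ] L).toRingHom
      _ _ _ _ _ _).trans h)
  have h1 := congrArg (MvPolynomial.eval ![1, 10, 1000]) h0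
  simp only [map_involutionDet, eval_signedVar, map_zero] at h1
  exact Int.cast_eq_zero.mp ((map_involutionDet (Int.castRingHom ℚ) _ _ _ _ _ _).trans h1)

lemma aeval_signedVar_injective {L : Type*} [Field L] [CharZero L] {x : Fin 3 → L}
    (hx : AlgebraicIndependent ℚ x) :
    Function.Injective fun i => MvPolynomial.aeval x (signedVar i) := by
  intro i j hij
  have h1 := congrArg (MvPolynomial.eval ![1, 10, 1000]) (hx hij)
  simp only [eval_signedVar, Int.cast_inj] at h1
  have key : Function.Injective signedInt := by decide
  exact key h1

set_option synthInstance.maxSize 1000 in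
/-- The only involution of the six integer points all of whose pairs satisfy the determinant
condition is the negation. -/
lemma eq_neg_of_involutionDet (s₀ s₁ s₂ s₃ s₄ s₅ : Fin 6)
    (hs : ∀ i, ![s₀, s₁, s₂, s₃, s₄, s₅] (![s₀, s₁, s₂, s₃, s₄, s₅] i) = i)
    (hD : ∀ i j k, involutionDet (signedInt i) (signedInt (![s₀, s₁, s₂, s₃, s₄, s₅] i))
      (signedInt j) (signedInt (![s₀, s₁, s₂, s₃, s₄, s₅] j))
      (signedInt k) (signedInt (![s₀, s₁, s₂, s₃, s₄, s₅] k)) = 0) :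
    s₀ = 1 ∧ s₂ = 3 := by
  have key : ∀ s₀ s₁ : Fin 6, (s₀ = 1 ↔ s₁ = 0) → s₀ ≠ s₁ →
      ∀ s₂ : Fin 6, (s₀ = 2 ↔ s₂ = 0) → (s₁ = 2 ↔ s₂ = 1) →
      ∀ s₃ : Fin 6, (s₀ = 3 ↔ s₃ = 0) → (s₁ = 3 ↔ s₃ = 1) → (s₂ = 3 ↔ s₃ = 2) →
      ∀ s₄ : Fin 6, (s₀ = 4 ↔ s₄ = 0) → (s₁ = 4 ↔ s₄ = 1) → (s₂ = 4 ↔ s₄ = 2) →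
        (s₃ = 4 ↔ s₄ = 3) →
      ∀ s₅ : Fin 6, (s₀ = 5 ↔ s₅ = 0) → (s₁ = 5 ↔ s₅ = 1) → (s₂ = 5 ↔ s₅ = 2) →
        (s₃ = 5 ↔ s₅ = 3) → (s₄ = 5 ↔ s₅ = 4) →
      (∀ i j k, i < j → j < k →
        involutionDet (signedInt i) (signedInt (![s₀, s₁, s₂, s₃, s₄, s₅] i))
        (signedInt j) (signedInt (![s₀, s₁, s₂, s₃, s₄, s₅] j))
        (signedInt k) (signedInt (![s₀, s₁, s₂, s₃, s₄, s₅] k)) = 0) → s₀ = 1 ∧ s₂ = 3 := by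
    unfold involutionDet
    decide +kernel
  have hiff : ∀ i j, ![s₀, s₁, s₂, s₃, s₄, s₅] i = j ↔ ![s₀, s₁, s₂, s₃, s₄, s₅] j = i :=
    fun i j => ⟨fun h => h ▸ hs i, fun h => h ▸ hs j⟩
  have hinj : ![s₀, s₁, s₂, s₃, s₄, s₅] 0 ≠ ![s₀, s₁, s₂, s₃, s₄, s₅] 1 := fun h =>
    absurd ((hs 0).symm.trans ((congrArg _ h).trans (hs 1))) (by decide)
  exact key s₀ s₁ (hiff 0 1) hinj s₂ (hiff 0 2) (hiff 1 2) s₃ (hiff 0 3) (hiff 1 3) (hiff 2 3)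
    s₄ (hiff 0 4) (hiff 1 4) (hiff 2 4) (hiff 3 4)
    s₅ (hiff 0 5) (hiff 1 5) (hiff 2 5) (hiff 3 5) (hiff 4 5) fun i j k _ _ => hD i j k

/-- A non-scalar `2 × 2` matrix with scalar square has trace zero. -/
lemma trace_eq_zero_of_sq_scalar {L : Type*} [Field L] {a b c d : L}
    (hnotid : ¬ ∃ k : L, !![a, b; c, d] = k • (1 : Matrix (Fin 2) (Fin 2) L))
    (hinv : ∃ k : L, !![a, b; c, d] * !![a, b; c, d] = k • (1 : Matrix (Fin 2) (Fin 2) L)) :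
    a + d = 0 := by
  obtain ⟨k, hk⟩ := hinv
  by_contra had
  have e00 := congrFun (congrFun hk 0) 0
  have e01 := congrFun (congrFun hk 0) 1
  have e10 := congrFun (congrFun hk 1) 0
  have e11 := congrFun (congrFun hk 1) 1
  simp [Matrix.mul_apply, Fin.sum_univ_two] at e00 e01 e10 e11
  have hb : b = 0 := (mul_eq_zero.mp (by linear_combination e01 : (a + d) * b = 0)).resolve_left had
  have hc : c = 0 := (mul_eq_zero.mp (by linear_combination e10 : (a + d) * c = 0)).resolve_left had
  have hd : a - d = 0 := (mul_eq_zero.mp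
    (by linear_combination e00 - e11 : (a + d) * (a - d) = 0)).resolve_left had
  refine hnotid ⟨a, ?_⟩
  ext i j
  fin_cases i <;> fin_cases j <;> simp [hb, hc, (sub_eq_zero.mp hd).symm]


/-- Let `L` be a field of characteristic `0` and `x₁, x₂, x₃ ∈ L` algebraically
independent over `ℚ`. If `h(t) = (at+b)/(ct+d)` (with `ad − bc ≠ 0`) is a Möbius
involution over `L` (not the identity, but its square is the identity, encoded
on the matrix `!![a,b;c,d]`: not scalar, but with scalar square) that maps the
six-element set `B₂ = {x₁, −x₁, x₂, −x₂, x₃, −x₃}` onto itself, then `h` is the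
map `x ↦ −x`, i.e. `b = 0`, `c = 0` and `a = −d`. -/
theorem stmt_10 {L : Type*} [Field L] [CharZero L] (x₁ x₂ x₃ : L)
    (hind : AlgebraicIndependent ℚ ![x₁, x₂, x₃])
    (a b c d : L) (habcd : a * d - b * c ≠ 0)
    (hnotid : ¬ ∃ k : L, !![a, b; c, d] = k • (1 : Matrix (Fin 2) (Fin 2) L))
    (hinv : ∃ k : L, !![a, b; c, d] * !![a, b; c, d] = k • (1 : Matrix (Fin 2) (Fin 2) L))
    (hdef : ∀ t ∈ ({x₁, -x₁, x₂, -x₂, x₃, -x₃} : Set L), c * t + d ≠ 0)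
    (himg : (fun t => (a * t + b) / (c * t + d)) '' ({x₁, -x₁, x₂, -x₂, x₃, -x₃} : Set L)
      = ({x₁, -x₁, x₂, -x₂, x₃, -x₃} : Set L)) :
    b = 0 ∧ c = 0 ∧ a = -d := by
  obtain rfl : d = -a := by linear_combination trace_eq_zero_of_sq_scalar hnotid hinv
  have hdet : a * a + b * c ≠ 0 := fun h => habcd (by linear_combination -h)
  set v : Fin 6 → L := fun i => MvPolynomial.aeval ![x₁, x₂, x₃] (signedVar i) with hv
  have hinj : Function.Injective v := aeval_signedVar_injective hind
  have v0 : v 0 = x₁ := by simp [hv, signedVar]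
  have v1 : v 1 = -x₁ := by simp [hv, signedVar]
  have v2 : v 2 = x₂ := by simp [hv, signedVar]
  have v3 : v 3 = -x₂ := by simp [hv, signedVar]
  have v4 : v 4 = x₃ := by simp [hv, signedVar]
  have v5 : v 5 = -x₃ := by simp [hv, signedVar]
  have hset : ({x₁, -x₁, x₂, -x₂, x₃, -x₃} : Set L) = Set.range v := by
    ext t
    have : (∃ i, v i = t) ↔ v 0 = t ∨ v 1 = t ∨ v 2 = t ∨ v 3 = t ∨ v 4 = t ∨ v 5 = t := by
      simp [Fin.exists_fin_succ]
    rw [Set.mem_range, this, v0, v1, v2, v3, v4, v5]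
    simp only [Set.mem_insert_iff, Set.mem_singleton_iff, eq_comm (b := t)]
  rw [hset] at hdef himg
  have hσ : ∀ i, ∃ j, v j = (a * v i + b) / (c * v i + -a) := fun i => by
    have : (a * v i + b) / (c * v i + -a) ∈ Set.range v := himg ▸ ⟨v i, ⟨i, rfl⟩, rfl⟩
    exact this
  choose σ hσ using hσ
  have hrel : ∀ i, c * (v i * v (σ i)) - a * (v i + v (σ i)) - b = 0 := fun i => by
    have h := (eq_div_iff (hdef _ ⟨i, rfl⟩)).mp (hσ i)
    linear_combination h
  have hσσ : ∀ i, σ (σ i) = i := fun i => hinj <| sub_eq_zero.mp <|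
    (mul_eq_zero.mp (by linear_combination hrel (σ i) - hrel i :
      (c * v (σ i) + -a) * (v (σ (σ i)) - v i) = 0)).resolve_left (hdef _ ⟨σ i, rfl⟩)
  have hσ_eq : ![σ 0, σ 1, σ 2, σ 3, σ 4, σ 5] = σ := by
    ext i
    fin_cases i <;> rfl
  obtain ⟨h0, h2⟩ := eq_neg_of_involutionDet (σ 0) (σ 1) (σ 2) (σ 3) (σ 4) (σ 5)
    (by rw [hσ_eq]; exact hσσ)
    (by
      rw [hσ_eq]
      exact fun i j k => involutionDet_signedInt_eq_zero hind
        (involutionDet_eq_zero hdet (hrel i) (hrel j) (hrel k)))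
  have r0 := hrel 0
  have r2 := hrel 2
  rw [h0, v0, v1] at r0
  rw [h2, v2, v3] at r2
  have hsub : x₁ - x₂ ≠ 0 := fun h =>
    absurd (hinj (v0.trans ((sub_eq_zero.mp h).trans v2.symm))) (by decide)
  have hadd : x₁ + x₂ ≠ 0 := fun h =>
    absurd (hinj (v0.trans ((eq_neg_of_add_eq_zero_left h).trans v3.symm))) (by decide)
  have hc : c = 0 := (mul_eq_zero.mp (by linear_combination r2 - r0 :
    c * ((x₁ - x₂) * (x₁ + x₂)) = 0)).resolve_right (mul_ne_zero hsub hadd)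
  refine ⟨?_, hc, (neg_neg a).symm⟩
  linear_combination -r0 - x₁ * x₁ * hc
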